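/- arXiv:2603.00417 — 8 statements merged into one kernel-verified Lean document; each statement's English description precedes it below -/
import Mathlib

section
/- Let X be a set and let ℱ be a union bounded family of finite subsets of X. If ℱ admits an (m+1) → m monotone compression scheme for some m ∈ ℕ, then for every n ≥ m+1, ℱ admits an n → m monotone compression scheme; that is, there exists a reconstruction function η_n : X^m → ℱ such that for every F ∈ ℱ and every sequence x₁,…,x_n of elements of F there exist indices i₁ < ⋯ < i_m ≤ n with {x₁,…,x_n} ⊆ η_n(x_{i₁},…,x_{i_m}). -/
/-- An `m → d` monotone compression scheme for a family `ℱ` of finite subsets of `X`: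
a reconstruction function `η : X^d → ℱ` such that every sequence of `m` points inside a
member of `ℱ` can be compressed to a subsequence of `d` of them whose reconstruction
contains all `m` points. -/
def MonotoneCompression {X : Type*} (ℱ : Set (Finset X)) (m d : ℕ) : Prop :=
  ∃ η : (Fin d → X) → Finset X, (∀ s, η s ∈ ℱ) ∧
    ∀ F ∈ ℱ, ∀ x : Fin m → X, (∀ j, x j ∈ F) →
      ∃ ι : Fin d → Fin m, StrictMono ι ∧ ∀ j, x j ∈ η (x ∘ ι)

/-- `ℱ` is union bounded if any two members are jointly contained in a third member. -/
def UnionBounded {X : Type*} (ℱ : Set (Finset X)) : Prop :=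
  ∀ F₁ ∈ ℱ, ∀ F₂ ∈ ℱ, ∃ F₃ ∈ ℱ, F₁ ⊆ F₃ ∧ F₂ ⊆ F₃

/-- Finitely many members of a union bounded family are jointly contained in a member. -/
theorem UnionBounded.exists_forall_subset {X α : Type*} {ℱ : Set (Finset X)}
    (hUB : UnionBounded ℱ) {F : Finset X} (hF : F ∈ ℱ) {f : α → Finset X}
    (hf : ∀ a, f a ∈ ℱ) (A : Finset α) :
    ∃ G ∈ ℱ, F ⊆ G ∧ ∀ a ∈ A, f a ⊆ G := by
  classical
  induction A using Finset.induction_on with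
  | empty => exact ⟨F, hF, subset_rfl, by simp⟩
  | insert a A _ ih =>
    obtain ⟨G, hG, hFG, hAG⟩ := ih
    obtain ⟨H, hH, hGH, haH⟩ := hUB G hG (f a) (hf a)
    refine ⟨H, hH, hFG.trans hGH, fun b hb => ?_⟩
    obtain rfl | hb := Finset.mem_insert.mp hb
    · exact haH
    · exact (hAG b hb).trans hGH

/-- Appending the last index to a strictly increasing sequence of earlier indices. -/
theorem strictMono_snoc_castSucc_last {m n : ℕ} {ι : Fin m → Fin n} (hι : StrictMono ι) :
    StrictMono (Fin.snoc (Fin.castSucc ∘ ι) (Fin.last n) : Fin (m + 1) → Fin (n + 1)) := by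
  intro i j hij
  induction j using Fin.lastCases with
  | last =>
    induction i using Fin.lastCases with
    | last => exact absurd hij (lt_irrefl _)
    | cast i => simp
  | cast j =>
    induction i using Fin.lastCases with
    | last => exact absurd hij (Fin.castSucc_lt_last j).not_gt
    | cast i => simpa using hι (Fin.castSucc_lt_castSucc_iff.mp hij)

/-- An `(m+1) → m` scheme can be used to lengthen the inputs of an `n → m` scheme by one. -/
theorem MonotoneCompression.succ {X : Type*} {ℱ : Set (Finset X)} (hUB : UnionBounded ℱ)
    {m n : ℕ} (h : MonotoneCompression ℱ (m + 1) m) (hn : MonotoneCompression ℱ n m) :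
    MonotoneCompression ℱ (n + 1) m := by
  obtain ⟨η, hη, hηc⟩ := h
  obtain ⟨θ, hθ, hθc⟩ := hn
  choose ψ hψ hηψ hθψ using fun s : Fin m → X =>
    hUB.exists_forall_subset (hη s) hθ (Fintype.piFinset fun _ : Fin m => η s)
  refine ⟨ψ, hψ, fun F hF x hx => ?_⟩
  obtain ⟨ι, hι, hιc⟩ := hθc F hF (x ∘ Fin.castSucc) fun j => hx _
  let e : Fin (m + 1) → Fin (n + 1) := Fin.snoc (Fin.castSucc ∘ ι) (Fin.last n)
  obtain ⟨κ, hκ, hκc⟩ := hηc F hF (x ∘ e) fun j => hx _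
  refine ⟨e ∘ κ, (strictMono_snoc_castSucc_last hι).comp hκ, fun j => ?_⟩
  induction j using Fin.lastCases with
  | last => exact hηψ _ (by simpa [e, Function.comp_assoc] using hκc (Fin.last m))
  | cast j =>
    refine hθψ _ _ (Fintype.mem_piFinset.mpr fun k => ?_) (hιc j)
    simpa [e, Function.comp_assoc] using hκc k.castSucc

/-- Boosting: an `(m+1) → m` monotone compression scheme for a union bounded family
yields an `n → m` monotone compression scheme for every `n ≥ m+1`. -/
theorem boosting_monotone_compression {X : Type*} (ℱ : Set (Finset X))
    (hUB : UnionBounded ℱ) (m : ℕ) (h : MonotoneCompression ℱ (m + 1) m) :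
    ∀ n : ℕ, m + 1 ≤ n → MonotoneCompression ℱ n m := by
  intro n hn
  induction n, hn using Nat.le_induction with
  | base => exact h
  | succ n _ ih => exact h.succ hUB ih
end

section
/- Let X be a set and let ℱ be a union bounded family of finite subsets of X. If ℱ admits an (m+1) → m monotone compression scheme for some m ∈ ℕ, then ℱ is (1/3, 1/3)-EMX learnable over the class of finitely supported probability distributions on X. -/
open scoped ENNReal

/-- The probability, under the i.i.d. product of `d` copies of `P`, of the event `E`
of `d`-tuples of samples. -/
noncomputable def iidProb {X : Type*} {d : ℕ} (P : PMF X) (E : Set (Fin d → X)) : ℝ≥0∞ :=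
  ∑' s : Fin d → X, Set.indicator E (fun s => ∏ i, P (s i)) s

/-- `opt_ℱ(P) = sup_{F ∈ ℱ} P(F)`. -/
noncomputable def emxOpt {X : Type*} (ℱ : Set (Finset X)) (P : PMF X) : ℝ≥0∞ :=
  ⨆ F ∈ ℱ, P.toOuterMeasure (F : Set X)

/-- `(ε,δ)`-EMX learnability of `ℱ` over finitely supported distributions: some proper
learner `G` on samples of some fixed size `d` outputs, with `P^d`-probability at least
`1 - δ`, a member of `ℱ` capturing `P`-mass at least `opt_ℱ(P) - ε`. -/
def EMXLearnable {X : Type*} (ℱ : Set (Finset X)) (ε δ : ℝ≥0∞) : Prop :=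
  ∃ (d : ℕ) (G : (Fin d → X) → Finset X), (∀ s, G s ∈ ℱ) ∧
    ∀ P : PMF X, P.support.Finite →
      1 - δ ≤ iidProb P {s | emxOpt ℱ P - ε ≤ P.toOuterMeasure ((G s : Set X))}

open Finset in
/-- A finite subfamily of a nonempty union bounded family is covered by a single member. -/
lemma UnionBounded.exists_superset {X α : Type*} {ℱ : Set (Finset X)} (hUB : UnionBounded ℱ)
    (hne : ℱ.Nonempty) (I : Finset α) (f : α → Finset X) (hf : ∀ i ∈ I, f i ∈ ℱ) :
    ∃ F ∈ ℱ, ∀ i ∈ I, f i ⊆ F := by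
  classical
  induction I using Finset.induction_on with
  | empty => exact ⟨_, hne.some_mem, by simp⟩
  | insert a s _ ih =>
    obtain ⟨F, hF, hs⟩ := ih fun i hi => hf i (mem_insert_of_mem hi)
    obtain ⟨F', hF', h₁, h₂⟩ := hUB F hF (f a) (hf a (mem_insert_self a s))
    refine ⟨F', hF', fun i hi => ?_⟩
    rcases mem_insert.1 hi with rfl | hi
    · exact h₂
    · exact (hs i hi).trans h₁

/-- `η` reconstructs every nonempty set of at most `k` points lying in a member of `ℱ` from some
`m`-tuple of its points. -/
def Reconstructs {X : Type*} (ℱ : Set (Finset X)) {m : ℕ} (η : (Fin m → X) → Finset X)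
    (k : ℕ) : Prop :=
  ∀ F ∈ ℱ, ∀ A ⊆ F, A.Nonempty → A.card ≤ k → ∃ t : Fin m → X, (∀ j, t j ∈ A) ∧ A ⊆ η t

/-- In a union bounded family, an `(m+1) → m` scheme yields reconstruction of sets of any
bounded size from `m` points. -/
lemma UnionBounded.exists_reconstructs {X : Type*} {ℱ : Set (Finset X)} (hUB : UnionBounded ℱ)
    {m : ℕ} (h : MonotoneCompression ℱ (m + 1) m) (k : ℕ) :
    ∃ η : (Fin m → X) → Finset X, (∀ s, η s ∈ ℱ) ∧ Reconstructs ℱ η k := by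
  classical
  obtain ⟨η, hη, hc⟩ := h
  induction k with
  | zero =>
    refine ⟨η, hη, fun F _ A _ hA hk => ?_⟩
    have := hA.card_pos
    omega
  | succ k ih =>
    obtain ⟨η', hη', hr⟩ := ih
    have key : ∀ y : Fin m → X, ∃ F ∈ ℱ, η y ⊆ F ∧ ∀ t : Fin m → X, (∀ j, t j ∈ η y) →
        η' t ⊆ F := by
      intro y
      obtain ⟨F, hF, hF'⟩ := hUB.exists_superset ⟨_, hη y⟩
        (Fintype.piFinset fun _ : Fin m => η y) η' fun t _ => hη' t
      obtain ⟨F', hF'ℱ, h₁, h₂⟩ := hUB F hF _ (hη y)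
      exact ⟨F', hF'ℱ, h₂, fun t ht => (hF' t (by simpa using ht)).trans h₁⟩
    choose η'' hη'' hsub hsub' using key
    refine ⟨η'', hη'', fun F hF A hAF ⟨a, ha⟩ hk => ?_⟩
    obtain ⟨t, htA, hta⟩ : ∃ t : Fin m → X, (∀ j, t j ∈ A) ∧
        (A.erase a = ∅ ∨ A.erase a ⊆ η' t) := by
      rcases (A.erase a).eq_empty_or_nonempty with he | hne
      · exact ⟨fun _ => a, fun _ => ha, Or.inl he⟩
      · obtain ⟨t, ht, ht'⟩ := hr F hF (A.erase a) ((A.erase_subset a).trans hAF) hne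
          (by rw [Finset.card_erase_of_mem ha]; omega)
        exact ⟨t, fun j => Finset.mem_of_mem_erase (ht j), Or.inr ht'⟩
    have hx : ∀ j, (Fin.cons a t : Fin (m + 1) → X) j ∈ A :=
      Fin.cases (by simpa using ha) (by simpa using htA)
    obtain ⟨ι, -, hι⟩ := hc F hF (Fin.cons a t) fun j => hAF (hx j)
    refine ⟨Fin.cons a t ∘ ι, fun j => hx (ι j), fun b hb => ?_⟩
    by_cases hba : b = a
    · subst hba
      exact hsub _ (by simpa using hι 0)
    · have hb' : b ∈ A.erase a := Finset.mem_erase.2 ⟨hba, hb⟩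
      rcases hta with he | hta
      · simp [he] at hb'
      · exact hsub' _ t (fun j => by simpa using hι j.succ) (hta hb')

open Classical in
/-- A learner whose output contains everything reconstructed from the sample misses at most `m`
of `n + 1` points when each is predicted from the remaining ones. -/
lemma UnionBounded.card_leave_one_out_le {X : Type*} {ℱ : Set (Finset X)} (hUB : UnionBounded ℱ)
    {m n : ℕ} {η : (Fin m → X) → Finset X} (hη : Reconstructs ℱ η (n + 1))
    {G : (Fin n → X) → Finset X}
    (hG : ∀ s t, (∀ j, t j ∈ Set.range s) → η t ⊆ G s) (x : Fin (n + 1) → X) :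
    (Finset.univ.filter fun i => x i ∈ {a | ∃ F ∈ ℱ, a ∈ F} \
      (G (fun j => x (i.succAbove j)) : Set X)).card ≤ m := by
  set U : Set X := {a | ∃ F ∈ ℱ, a ∈ F}
  let A : Finset X := (Finset.univ.image x).filter (· ∈ U)
  have hxA : ∀ i, x i ∈ U → x i ∈ A := fun i hi => by simp [A, hi]
  rcases A.eq_empty_or_nonempty with hA | hA
  · rw [Finset.card_eq_zero.2]
    · exact Nat.zero_le m
    · refine Finset.filter_eq_empty_iff.2 fun i _ hi => ?_
      have := hxA i hi.1
      simp [hA] at this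
  · have hAU : ∀ a ∈ A, ∃ F ∈ ℱ, a ∈ F := fun a ha => (Finset.mem_filter.1 ha).2
    have hne : ℱ.Nonempty := by
      obtain ⟨a, ha⟩ := hA
      obtain ⟨F, hF, -⟩ := hAU a ha
      exact ⟨F, hF⟩
    have : Nonempty (Finset X) := ⟨∅⟩
    choose! f hf haf using hAU
    obtain ⟨F, hF, hAF⟩ := hUB.exists_superset hne A f hf
    have hcard : A.card ≤ n + 1 :=
      (Finset.card_filter_le _ _).trans (Finset.card_image_le.trans (by simp))
    obtain ⟨t, htA, hAt⟩ := hη F hF A (fun a ha => hAF a ha (haf a ha)) hA hcard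
    have hσ : ∀ j, ∃ i, x i = t j := fun j => by
      simpa using (Finset.mem_filter.1 (htA j)).1
    choose σ hσ using hσ
    calc _ ≤ (Finset.univ.image σ).card := Finset.card_le_card fun i hi => ?_
      _ ≤ m := Finset.card_image_le.trans (by simp)
    by_contra hiσ
    obtain ⟨hiU, hiG⟩ := (Finset.mem_filter.1 hi).2
    refine hiG (hG _ t (fun j => ?_) (hAt (hxA i hiU)))
    have hji : σ j ≠ i := fun e => hiσ (by simp [← e])
    obtain ⟨k, hk⟩ := Fin.exists_succAbove_eq hji
    exact ⟨k, by rw [← hσ, ← hk]⟩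

/-- Splitting off the `i`-th coordinate of a sum over tuples. -/
lemma tsum_fin_succ_eq {X : Type*} {n : ℕ} (i : Fin (n + 1)) (f : (Fin (n + 1) → X) → ℝ≥0∞) :
    ∑' x, f x = ∑' s : Fin n → X, ∑' a, f (i.insertNth a s) := by
  rw [← (Fin.insertNthEquiv (fun _ => X) i).tsum_eq, ENNReal.tsum_prod',
    ENNReal.tsum_comm]
  rfl

lemma tsum_prod_pmf_eq_one {X : Type*} (P : PMF X) (n : ℕ) :
    ∑' s : Fin n → X, ∏ i, P (s i) = 1 := by
  induction n with
  | zero => simp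
  | succ n ih =>
    rw [tsum_fin_succ_eq 0]
    simp [Fin.prod_univ_succ, ENNReal.tsum_mul_right, P.tsum_coe, ih]

/-- If `x i` hits `D` of the remaining coordinates for at most `m` indices `i`, then the expected
mass of `D` on `n` samples is at most `m / (n + 1)`. -/
lemma tsum_prod_mul_le_of_leave_one_out {X : Type*} (P : PMF X) {m n : ℕ}
    (D : (Fin n → X) → Set X)
    (hD : ∀ x : Fin (n + 1) → X, {i | x i ∈ D fun j => x (i.succAbove j)}.ncard ≤ m) :
    (n + 1) * ∑' s : Fin n → X, (∏ i, P (s i)) * P.toOuterMeasure (D s) ≤ m := by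
  classical
  have hi : ∀ i : Fin (n + 1), ∑' x : Fin (n + 1) → X, (∏ k, P (x k)) *
      (if x i ∈ D (fun j => x (i.succAbove j)) then 1 else 0) =
      ∑' s : Fin n → X, (∏ i, P (s i)) * P.toOuterMeasure (D s) := by
    intro i
    rw [tsum_fin_succ_eq i]
    refine tsum_congr fun s => ?_
    rw [PMF.toOuterMeasure_apply, ← ENNReal.tsum_mul_left]
    refine tsum_congr fun a => ?_
    simp only [Fin.prod_univ_succAbove _ i, Fin.insertNth_apply_same,
      Fin.insertNth_apply_succAbove, Set.indicator_apply]
    split_ifs <;> simp [mul_comm]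
  calc _ = ∑ i : Fin (n + 1), ∑' x : Fin (n + 1) → X, (∏ k, P (x k)) *
      (if x i ∈ D (fun j => x (i.succAbove j)) then 1 else 0) := by
        rw [Finset.sum_congr rfl fun i _ => hi i]
        simp
    _ = ∑' x : Fin (n + 1) → X, (∏ k, P (x k)) *
        ∑ i, (if x i ∈ D (fun j => x (i.succAbove j)) then 1 else 0) := by
        simp only [Finset.mul_sum]
        exact (Summable.tsum_finsetSum fun _ _ => ENNReal.summable).symm
    _ ≤ ∑' x : Fin (n + 1) → X, (∏ k, P (x k)) * m := by
        refine ENNReal.tsum_le_tsum fun x => mul_le_mul_right ?_ _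
        have := hD x
        rw [Set.ncard_eq_toFinset_card', Set.toFinset_ofPred] at this
        simpa using this
    _ = m := by rw [ENNReal.tsum_mul_right, tsum_prod_pmf_eq_one, one_mul]

/-- Markov's inequality for `iidProb`, bounding the mass of the complementary event. -/
lemma one_sub_le_iidProb {X : Type*} {d : ℕ} (P : PMF X) (E : Set (Fin d → X))
    (B : (Fin d → X) → ℝ≥0∞) (hB : ∀ s ∉ E, 1 ≤ B s) :
    1 - ∑' s, (∏ i, P (s i)) * B s ≤ iidProb P E := by
  classical
  rw [tsub_le_iff_right, ← tsum_prod_pmf_eq_one P d, iidProb, ← ENNReal.tsum_add]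
  refine ENNReal.tsum_le_tsum fun s => ?_
  by_cases hs : s ∈ E
  · simp [hs]
  · simpa [hs] using mul_le_mul_right (hB s hs) (∏ i, P (s i))

/-- If a union bounded family of finite subsets of `X` admits an `(m+1) → m` monotone
compression scheme for some `m`, then it is `(1/3, 1/3)`-EMX learnable over the class of
finitely supported probability distributions on `X`. -/
theorem emx_learnable_of_monotone_compression {X : Type*} (ℱ : Set (Finset X))
    (hUB : UnionBounded ℱ) (m : ℕ) (h : MonotoneCompression ℱ (m + 1) m) :
    EMXLearnable ℱ (1/3) (1/3) := by
  classical
  obtain ⟨n, hn⟩ : ∃ n, n = 9 * m + 1 := ⟨_, rfl⟩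
  obtain ⟨η, hηℱ, hη⟩ := hUB.exists_reconstructs h (n + 1)
  have hcover : ∀ s : Fin n → X, ∃ F ∈ ℱ, ∀ t : Fin m → X, (∀ j, t j ∈ Set.range s) →
      η t ⊆ F := by
    intro s
    obtain ⟨F, hF, hsub⟩ := hUB.exists_superset ⟨_, hηℱ fun _ => s ⟨0, by omega⟩⟩
      (Fintype.piFinset fun _ : Fin m => Finset.univ.image s) η fun t _ => hηℱ t
    exact ⟨F, hF, fun t ht => hsub t (by simpa using ht)⟩
  choose G hGℱ hG using hcover
  refine ⟨n, G, hGℱ, fun P _ => ?_⟩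
  set U : Set X := {a | ∃ F ∈ ℱ, a ∈ F}
  have hE := tsum_prod_mul_le_of_leave_one_out P (m := m) (fun s => U \ (G s : Set X)) fun x => by
    rw [Set.ncard_eq_toFinset_card', Set.toFinset_ofPred]
    exact hUB.card_leave_one_out_le hη hG x
  have hopt : emxOpt ℱ P ≤ P.toOuterMeasure U :=
    iSup₂_le fun F hF => P.toOuterMeasure.mono fun a ha => ⟨F, hF, ha⟩
  refine le_trans (tsub_le_tsub_left ?_ 1) (one_sub_le_iidProb P _
    (fun s => 3 * P.toOuterMeasure (U \ (G s : Set X))) fun s hs => ?_)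
  · set e := ∑' s : Fin n → X, (∏ i, P (s i)) * P.toOuterMeasure (U \ (G s : Set X))
    have hsum : ∑' s : Fin n → X, (∏ i, P (s i)) * (3 * P.toOuterMeasure (U \ (G s : Set X))) =
        3 * e := by
      rw [← ENNReal.tsum_mul_left]
      exact tsum_congr fun s => by ring
    rw [hsum]
    have hfin : e ≠ ∞ := by
      rintro h
      rw [h, ENNReal.mul_top (by positivity)] at hE
      simp at hE
    clear_value e
    lift e to NNReal using hfin
    have hE' : ((n : NNReal) + 1) * e ≤ m := by exact_mod_cast hE
    have h3 : 3 * e ≤ 1 / 3 := by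
      rw [← NNReal.coe_le_coe] at hE' ⊢
      push_cast [hn] at hE' ⊢
      have hm : (0 : ℝ) ≤ m := Nat.cast_nonneg m
      by_contra! hlt
      nlinarith
    have := ENNReal.coe_le_coe.2 h3
    rwa [ENNReal.coe_mul, ENNReal.coe_div (by norm_num)] at this
  · simp only [Set.mem_ofPred_eq, not_le] at hs
    have hle : emxOpt ℱ P ≤ P.toOuterMeasure (G s) + P.toOuterMeasure (U \ (G s : Set X)) := by
      refine hopt.trans ((P.toOuterMeasure.mono ?_).trans (MeasureTheory.measure_union_le _ _))
      intro a ha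
      by_cases h : a ∈ (G s : Set X)
      · exact Or.inl h
      · exact Or.inr ⟨ha, h⟩
    by_contra! hlt
    have hlt' : P.toOuterMeasure (U \ (G s : Set X)) ≤ 1 / 3 := by
      rw [ENNReal.le_div_iff_mul_le (by simp) (by simp), mul_comm]
      exact hlt.le
    exact absurd hs (not_lt.2 (tsub_le_iff_right.2 (hle.trans (by gcongr))))
end

section
/- Fix an integer k ≥ 0 and a set X. If the cardinality of X is at most ℵ_k, then the family ℱ_fin^X of all finite subsets of X admits a (k+2) → (k+1) monotone compression scheme. -/
open Cardinal in
/-- The Kuratowski–Sierpiński set mapping theorem for sets of cardinality less than `ℵ_n`. -/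
theorem exists_setMapping_of_mk_lt_aleph {X : Type*} [DecidableEq X] (n : ℕ) (A : Set X)
    (hA : #A < ℵ_ n) :
    ∃ g : Finset X → Finset X, ∀ S : Finset X, (S : Set X) ⊆ A → S.card = n + 1 →
      ∃ y ∈ S, y ∈ g (S.erase y) := by
  induction n generalizing A with
  | zero =>
    have hfin : A.Finite := by simpa [Cardinal.lt_aleph0_iff_set_finite] using hA
    refine ⟨fun _ ↦ hfin.toFinset, fun S hS hc ↦ ?_⟩
    obtain ⟨y, hy⟩ := Finset.card_pos.1 (by omega : 0 < S.card)
    exact ⟨y, hy, hfin.mem_toFinset.2 (hS hy)⟩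
  | succ n ih =>
    have hle : #A ≤ #(ℵ_ n).ord.ToType := by
      rw [Cardinal.mk_ord_toType, ← Order.lt_succ_iff, Cardinal.succ_aleph]
      simpa using hA
    obtain ⟨e⟩ := hle
    have hseg (a : A) : #(Subtype.val '' {y : A | e y < e a}) < ℵ_ n := by
      refine Cardinal.mk_image_le.trans_lt (lt_of_le_of_lt ?_
        ((Cardinal.mk_Iio_lt (e a) (by simp)).trans_eq (Cardinal.mk_ord_toType _)))
      exact Cardinal.mk_le_of_injective (f := fun y ↦ ⟨e y.1, y.2⟩) fun y z h ↦
        Subtype.ext (e.injective (Subtype.ext_iff.1 h))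
    choose g hg using fun a : A ↦ ih _ (hseg a)
    classical
    refine ⟨fun T ↦ T.biUnion fun a ↦ if ha : a ∈ A then g ⟨a, ha⟩ (T.erase a) else ∅,
      fun S hS hc ↦ ?_⟩
    obtain ⟨a, haS, hmax⟩ := S.attach.exists_max_image (fun a ↦ e ⟨a, hS a.2⟩)
      (by simpa using Finset.card_pos.1 (by omega : 0 < S.card))
    obtain ⟨y, hy, hyg⟩ := hg ⟨a, hS a.2⟩ (S.erase a) (by
      intro y hy
      obtain ⟨hya, hyS⟩ := Finset.mem_erase.1 (Finset.mem_coe.1 hy)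
      refine ⟨⟨y, hS hyS⟩, lt_of_le_of_ne (hmax ⟨y, hyS⟩ (Finset.mem_attach _ _)) ?_, rfl⟩
      exact fun h ↦ hya (Subtype.ext_iff.1 (e.injective h)))
      (by rw [Finset.card_erase_of_mem a.2]; omega)
    obtain ⟨hya, hyS⟩ := Finset.mem_erase.1 hy
    refine ⟨y, hyS, Finset.mem_biUnion.2 ⟨a, Finset.mem_erase.2 ⟨hya.symm, a.2⟩, ?_⟩⟩
    rwa [dif_pos (hS a.2), Finset.erase_right_comm]

/-- If the cardinality of `X` is at most `ℵ_k`, then the family of all finite subsets of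
`X` admits a `(k+2) → (k+1)` monotone compression scheme. -/
theorem compression_of_card_le_aleph {X : Type*} (k : ℕ)
    (h : Cardinal.mk X ≤ Cardinal.aleph k) :
    MonotoneCompression (Set.univ : Set (Finset X)) (k + 2) (k + 1) := by
  classical
  obtain ⟨g, hg⟩ := exists_setMapping_of_mk_lt_aleph (k + 1) (Set.univ : Set X) (by
    rw [Cardinal.mk_univ]
    exact h.trans_lt (Cardinal.aleph_lt_aleph.2 (by exact_mod_cast k.lt_succ_self)))
  refine ⟨fun s ↦ Finset.univ.image s ∪ g (Finset.univ.image s), fun _ ↦ Set.mem_univ _,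
    fun _ _ x _ ↦ ?_⟩
  suffices ∃ i, x i ∈ Finset.univ.image (x ∘ i.succAbove) ∪
      g (Finset.univ.image (x ∘ i.succAbove)) by
    obtain ⟨i, hi⟩ := this
    refine ⟨i.succAbove, i.strictMono_succAbove, fun j ↦ ?_⟩
    rcases Fin.eq_self_or_eq_succAbove i j with rfl | ⟨l, rfl⟩
    · exact hi
    · exact Finset.mem_union_left _ (Finset.mem_image_of_mem (x ∘ i.succAbove) (Finset.mem_univ l))
  by_cases hx : Function.Injective x
  · obtain ⟨y, hy, hyg⟩ := hg (Finset.univ.image x) (Set.subset_univ _)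
      (by simp [Finset.card_image_of_injective _ hx])
    obtain ⟨i, -, rfl⟩ := Finset.mem_image.1 hy
    refine ⟨i, Finset.mem_union_right _ ?_⟩
    convert hyg using 2
    rw [← Finset.image_image, Fin.image_succAbove_univ, Finset.compl_singleton,
      Finset.image_erase hx]
  · obtain ⟨i, j, hij, hne⟩ := Function.not_injective_iff.1 hx
    obtain ⟨l, rfl⟩ := Fin.exists_succAbove_eq hne.symm
    exact ⟨i, Finset.mem_union_left _ (Finset.mem_image.2 ⟨l, Finset.mem_univ l, hij.symm⟩)⟩
end

section
/- Let r ≥ 1 be an integer and let Y ⊂ X be infinite sets with the cardinality of Y strictly smaller than the cardinality of X. If the family ℱ_fin^X of all finite subsets of X admits an (r+1) → r monotone compression scheme, then the family ℱ_fin^Y of all finite subsets of Y admits an r → (r−1) monotone compression scheme. -/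
open Cardinal in
/-- A family of finite sets indexed by tuples from an infinite set `Y` cannot cover a set of
larger cardinality. -/
theorem exists_notMem_of_mk_lt {X : Type*} {Y : Set X} (hYinf : Y.Infinite)
    (hcard : #Y < #X) {n : ℕ} (f : (Fin n → Y) → Finset X) : ∃ a, ∀ s, a ∉ f s := by
  have := hYinf.to_subtype
  have hY : ℵ₀ ≤ #Y := aleph0_le_mk Y
  by_contra! hc
  have huniv : (⋃ s, (f s : Set X)) = Set.univ :=
    Set.eq_univ_of_forall fun a => Set.mem_iUnion.2 (hc a)
  have htuples : #(Fin n → Y) ≤ #Y := by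
    simpa using power_nat_le (n := n) hY
  refine hcard.not_ge ?_
  calc #X = #(⋃ s, (f s : Set X)) := by rw [huniv, mk_univ]
    _ ≤ #(Fin n → Y) * ⨆ s, #(f s : Set X) := mk_iUnion_le _
    _ ≤ #Y * ℵ₀ :=
      mul_le_mul' htuples (ciSup_le' fun s => (f s).finite_toSet.lt_aleph0.le)
    _ = #Y := mul_aleph0_eq hY

/-- Cardinality descent: if `Y ⊂ X` are infinite with `|Y| < |X|` and the family of all
finite subsets of `X` admits an `(r+1) → r` monotone compression scheme, then the family
of all finite subsets of `Y` admits an `r → (r-1)` monotone compression scheme. -/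
theorem compression_descent {X : Type*} [Infinite X] (Y : Set X) (r : ℕ) (hr : 1 ≤ r)
    (hYinf : Y.Infinite) (hYX : Y ⊂ Set.univ)
    (hcard : Cardinal.mk Y < Cardinal.mk X)
    (h : MonotoneCompression (Set.univ : Set (Finset X)) (r + 1) r) :
    MonotoneCompression (Set.univ : Set (Finset Y)) r (r - 1) := by
  classical
  obtain ⟨n, rfl⟩ : ∃ n, r = n + 1 := ⟨r - 1, by omega⟩
  change MonotoneCompression _ (n + 1) n
  obtain ⟨η, -, hη⟩ := h
  obtain ⟨a, ha⟩ := exists_notMem_of_mk_lt hYinf hcard fun s : Fin (n + 1) → Y =>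
    η fun j => s j
  refine ⟨fun z => (η (Fin.snoc (fun j => (z j : X)) a)).subtype (· ∈ Y),
    fun _ => Set.mem_univ _, fun _ _ y _ => ?_⟩
  let x : Fin (n + 2) → X := Fin.snoc (fun j => (y j : X)) a
  have hx (j : Fin (n + 1)) : x j.castSucc = y j := Fin.snoc_castSucc (α := fun _ => X) ..
  have hxlast : x (Fin.last _) = a := Fin.snoc_last (α := fun _ => X) ..
  obtain ⟨ι, hι, hcover⟩ := hη (Finset.univ.image x) (Set.mem_univ _) x fun j =>
    Finset.mem_image_of_mem x (Finset.mem_univ j)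
  have hιlast : ι (Fin.last n) = Fin.last (n + 1) := by
    by_contra hne
    have hne' (j : Fin (n + 1)) : ι j ≠ Fin.last (n + 1) :=
      ((hι.monotone (Fin.le_last j)).trans_lt (Fin.lt_last_iff_ne_last.2 hne)).ne
    refine ha (fun j => y ((ι j).castPred (hne' j))) ?_
    have hcomp : x ∘ ι = fun j => (y ((ι j).castPred (hne' j)) : X) := by
      funext j
      rw [← hx, Fin.castSucc_castPred, Function.comp_apply]
    rw [← hcomp, ← hxlast]
    exact hcover _
  have hne (j : Fin n) : ι j.castSucc ≠ Fin.last (n + 1) :=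
    (hιlast ▸ hι (Fin.castSucc_lt_last j)).ne
  refine ⟨fun j => (ι j.castSucc).castPred (hne j), fun i j hij => ?_, fun j => ?_⟩
  · exact Fin.castPred_lt_castPred_iff.2 (hι (Fin.castSucc_lt_castSucc_iff.2 hij))
  · have hcomp : x ∘ ι =
        Fin.snoc (fun j => (y ((ι j.castSucc).castPred (hne j)) : X)) a := by
      funext i
      refine Fin.lastCases ?_ (fun i => ?_) i
      · rw [Function.comp_apply, hιlast, hxlast, Fin.snoc_last]
      · rw [Fin.snoc_castSucc, ← hx, Fin.castSucc_castPred, Function.comp_apply]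
    have hmem := hcover j.castSucc
    rw [hcomp, hx] at hmem
    exact Finset.mem_subtype.2 hmem
end

section
/- Fix an integer k ≥ 0 and a set X. If the family ℱ_fin^X of all finite subsets of X admits a (k+2) → (k+1) monotone compression scheme, then the cardinality of X is at most ℵ_k. -/
open Cardinal in
/-- A form of Kuratowski's free set theorem: if `ℵ_k ≤ #α`, any finite-set-valued functions of
`k` variables admit a `(k+1)`-tuple none of whose entries is captured by the others. -/
theorem exists_free_tuple (k : ℕ) : ∀ {α : Type*}, ℵ_ (k : Ordinal) ≤ #α →
    ∀ η : Fin (k + 1) → (Fin k → α) → Finset α,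
      ∃ x : Fin (k + 1) → α, ∀ i, x i ∉ η i (x ∘ i.succAbove) := by
  induction k with
  | zero =>
    intro α hα η
    have : Infinite α := by simpa [infinite_iff] using hα
    obtain ⟨y, hy⟩ := Infinite.exists_notMem_finset (η 0 Fin.elim0)
    refine ⟨fun _ => y, fun i => ?_⟩
    rw [Fin.fin_one_eq_zero i]
    convert hy
  | succ k ih =>
    intro α hα η
    have hlt : ℵ_ (k : Ordinal) < #α :=
      (aleph_lt_aleph.2 (by exact_mod_cast Nat.lt_succ_self k)).trans_le hα
    obtain ⟨A, hA⟩ := le_mk_iff_exists_set.1 hlt.le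
    have hinf : ℵ₀ ≤ #A := hA ▸ aleph0_le_aleph _
    have hfun : #(Fin k.succ → A) ≤ #A := by
      rw [mk_arrow, mk_fin, lift_natCast, lift_uzero]
      exact power_nat_le hinf
    have hU : #(⋃ t : Fin (k + 1) → A, (η 0 (fun j => t j) : Set α)) ≤ #A := by
      refine (mk_iUnion_le _).trans ((mul_le_mul' hfun
        (ciSup_le' fun t => ?_)).trans (mul_eq_self hinf).le)
      exact (Cardinal.lt_aleph0_of_finite _).le.trans hinf
    obtain ⟨y, hy⟩ : ∃ y, y ∉ ⋃ t : Fin (k + 1) → A, (η 0 (fun j => t j) : Set α) := by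
      by_contra! hall
      rw [Set.eq_univ_of_forall hall, mk_univ, hA] at hU
      exact hlt.not_ge hU
    obtain ⟨t, ht⟩ := ih hA.ge fun i s =>
      (η i.succ (Fin.cons y fun j => (s j : α))).preimage Subtype.val
        Subtype.val_injective.injOn
    refine ⟨Fin.cons y fun j => (t j : α), Fin.cases ?_ fun i hi => ht i ?_⟩
    · intro h
      exact hy (Set.mem_iUnion.2 ⟨t, h⟩)
    · rw [Finset.mem_preimage]
      have hcons : (Fin.cons y (fun j => (t j : α)) : Fin (k + 2) → α) ∘ i.succ.succAbove =
          Fin.cons y fun j => (t (i.succAbove j) : α) := by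
        funext j
        cases j using Fin.cases <;> simp
      rwa [hcons] at hi

/-- A strictly monotone map `Fin n → Fin (n + 1)` skips exactly one value. -/
theorem StrictMono.exists_eq_succAbove {n : ℕ} {ι : Fin n → Fin (n + 1)} (hι : StrictMono ι) :
    ∃ i : Fin (n + 1), ι = i.succAbove := by
  obtain ⟨i, hi⟩ : ∃ i, i ∉ Set.range ι := by
    by_contra! hall
    simpa using Fintype.card_le_of_surjective ι hall
  refine ⟨i, (hι.range_inj i.strictMono_succAbove).1 ?_⟩
  rw [Fin.range_succAbove]
  refine Set.eq_of_subset_of_ncard_le (Set.subset_compl_singleton_iff.2 hi) ?_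
  rw [Set.ncard_compl, ← Set.image_univ, Set.ncard_image_of_injective _ hι.injective]
  simp

/-- If the family of all finite subsets of `X` admits a `(k+2) → (k+1)` monotone
compression scheme, then the cardinality of `X` is at most `ℵ_k`. -/
theorem card_le_aleph_of_compression {X : Type*} (k : ℕ)
    (h : MonotoneCompression (Set.univ : Set (Finset X)) (k + 2) (k + 1)) :
    Cardinal.mk X ≤ Cardinal.aleph k := by
  classical
  obtain ⟨η, -, hη⟩ := h
  by_contra! hlt
  have hle : Cardinal.aleph ((k + 1 : ℕ) : Ordinal) ≤ Cardinal.mk X := by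
    rw [Nat.cast_succ, ← Cardinal.succ_aleph]
    exact Order.succ_le_of_lt hlt
  obtain ⟨x, hx⟩ := exists_free_tuple (k + 1) hle fun _ => η
  obtain ⟨ι, hι, hmem⟩ := hη (Finset.univ.image x) trivial x fun j =>
    Finset.mem_image_of_mem x (Finset.mem_univ j)
  obtain ⟨i, rfl⟩ := hι.exists_eq_succAbove
  exact hx i (hmem i)
end

section
/- If X is a countable set, then the family ℱ_fin^X of all finite subsets of X is (1/3, 1/3)-EMX learnable over the class of finitely supported probability distributions on X. -/
open scoped ENNReal

theorem ENNReal.tsum_fin_pi_prod {X : Type*} (g : X → ℝ≥0∞) (n : ℕ) :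
    ∑' s : Fin n → X, ∏ i, g (s i) = (∑' x, g x) ^ n := by
  induction n with
  | zero => simp
  | succ n ih =>
    rw [← (Fin.consEquiv fun _ : Fin (n + 1) => X).tsum_eq, ENNReal.tsum_prod']
    simp [Fin.consEquiv, Fin.prod_univ_succ, ENNReal.tsum_mul_left, ENNReal.tsum_mul_right, ih,
      pow_succ']

theorem iidProb_univ {X : Type*} {d : ℕ} (P : PMF X) :
    iidProb P (Set.univ : Set (Fin d → X)) = 1 := by
  simp [iidProb, ENNReal.tsum_fin_pi_prod, P.tsum_coe]

theorem iidProb_mono {X : Type*} {d : ℕ} (P : PMF X) {E E' : Set (Fin d → X)} (h : E ⊆ E') :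
    iidProb P E ≤ iidProb P E' :=
  ENNReal.tsum_le_tsum fun s => Set.indicator_le_indicator_of_subset h (fun _ => zero_le) s

theorem iidProb_add_compl {X : Type*} {d : ℕ} (P : PMF X) (E : Set (Fin d → X)) :
    iidProb P E + iidProb P Eᶜ = 1 := by
  rw [← iidProb_univ (d := d) P, iidProb, iidProb, iidProb, ← ENNReal.tsum_add]
  refine tsum_congr fun s => ?_
  rw [Set.indicator_univ]
  exact Set.indicator_self_add_compl_apply E _ s

theorem iidProb_forall_mem {X : Type*} {d : ℕ} (P : PMF X) (A : Set X) :
    iidProb P {s : Fin d → X | ∀ i, s i ∈ A} = P.toOuterMeasure A ^ d := by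
  classical
  rw [PMF.toOuterMeasure_apply, ← ENNReal.tsum_fin_pi_prod, iidProb]
  refine tsum_congr fun s => ?_
  by_cases h : ∀ i, s i ∈ A
  · simp [Set.indicator, h]
  · obtain ⟨i, hi⟩ := not_forall.mp h
    rw [Set.indicator_of_notMem (by simpa using h), eq_comm]
    exact Finset.prod_eq_zero (Finset.mem_univ i) (Set.indicator_of_notMem hi _)

theorem PMF.toOuterMeasure_le_one {X : Type*} (P : PMF X) (A : Set X) :
    P.toOuterMeasure A ≤ 1 := by
  rw [PMF.toOuterMeasure_apply, ← P.tsum_coe]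
  exact ENNReal.tsum_le_tsum fun x => Set.indicator_le_self' (fun _ _ => zero_le) x

theorem emxOpt_le_one {X : Type*} (ℱ : Set (Finset X)) (P : PMF X) : emxOpt ℱ P ≤ 1 :=
  iSup₂_le fun _ _ => P.toOuterMeasure_le_one _

theorem PMF.exists_level_of_finite_support {X : Type*} (f : X → ℕ) (P : PMF X)
    (hP : P.support.Finite) {c : ℝ≥0∞} (hc : 0 < c) (hc1 : c ≤ 1) :
    ∃ m : ℕ, P.toOuterMeasure {x | f x < m} < c ∧ c ≤ P.toOuterMeasure {x | f x ≤ m} := by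
  classical
  have hex : ∃ n : ℕ, c ≤ P.toOuterMeasure {x | f x < n} := by
    obtain ⟨b, hb⟩ := (hP.image f).bddAbove
    refine ⟨b + 1, hc1.trans (le_of_eq ?_)⟩
    rw [eq_comm, PMF.toOuterMeasure_apply_eq_one_iff]
    exact fun x hx => Nat.lt_succ_of_le (hb (Set.mem_image_of_mem f hx))
  obtain ⟨m, hm⟩ : ∃ m, Nat.find hex = m + 1 := by
    refine Nat.exists_eq_succ_of_ne_zero fun h0 => ?_
    have h := Nat.find_spec hex
    rw [h0] at h
    simp at h
    exact hc.ne' h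
  refine ⟨m, not_le.mp (Nat.find_min hex (by omega)), ?_⟩
  simpa [hm, Nat.lt_succ_iff] using Nat.find_spec hex

/-- If `X` is countable, then the family of all finite subsets of `X` is `(1/3, 1/3)`-EMX
learnable over the class of finitely supported probability distributions on `X`. -/
theorem emx_learnable_finite_subsets_countable {X : Type*} [Countable X] :
    EMXLearnable (Set.univ : Set (Finset X)) (1/3) (1/3) := by
  obtain ⟨f, hf⟩ := exists_injective_nat X
  have hfin (s : Fin 3 → X) : {x | ∃ i, f x ≤ f (s i)}.Finite := by
    rw [Set.ofPred_exists]
    exact Set.finite_iUnion fun i => (Set.finite_Iic (f (s i))).preimage hf.injOn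
  refine ⟨3, fun s => (hfin s).toFinset, fun _ => Set.mem_univ _, fun P hP => ?_⟩
  have hsub : (1 - 1 / 3 : ℝ≥0∞) = ENNReal.ofReal (2 / 3) := by
    rw [← ENNReal.ofReal_one, show (3 : ℝ≥0∞) = ENNReal.ofReal 3 by simp,
      ← ENNReal.ofReal_div_of_pos (by norm_num), ← ENNReal.ofReal_sub _ (by norm_num)]
    norm_num
  obtain ⟨m, hlt, hle⟩ := P.exists_level_of_finite_support f hP (c := 1 - 1 / 3)
    (by rw [hsub]; simp) tsub_le_self
  set E := {s : Fin 3 → X |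
    emxOpt Set.univ P - 1 / 3 ≤ P.toOuterMeasure ((hfin s).toFinset : Set X)}
  have hbad : iidProb P Eᶜ ≤ 1 / 3 := by
    calc iidProb P Eᶜ ≤ iidProb P {s : Fin 3 → X | ∀ i, s i ∈ {x | f x < m}} := by
          refine iidProb_mono P fun s hs i => ?_
          by_contra hi
          refine hs ((tsub_le_tsub_right (emxOpt_le_one _ P) _).trans (hle.trans ?_))
          refine P.toOuterMeasure.mono fun x hx => ?_
          rw [Set.Finite.coe_toFinset]
          exact ⟨i, le_trans hx (not_lt.mp hi)⟩
      _ = P.toOuterMeasure {x | f x < m} ^ 3 := iidProb_forall_mem P _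
      _ ≤ (1 - 1 / 3) ^ 3 := by gcongr
      _ ≤ 1 / 3 := by
          rw [hsub, ← ENNReal.ofReal_pow (by norm_num), show (1 / 3 : ℝ≥0∞) =
            ENNReal.ofReal (1 / 3) by rw [ENNReal.ofReal_div_of_pos (by norm_num)]; simp]
          exact ENNReal.ofReal_le_ofReal (by norm_num)
  rw [tsub_le_iff_right]
  calc 1 = iidProb P E + iidProb P Eᶜ := (iidProb_add_compl P E).symm
    _ ≤ iidProb P E + 1 / 3 := by gcongr
end

section
/- Let n ≥ 2 and let H = ℂ^n with the standard Hermitian inner product; realize the tensor product H ⊗ H as ℂ^{n×n} with (ψ ⊗ φ)(i,j) = ψ(i)·φ(j). Fix a unit vector e₀ ∈ H. Then there is no linear map U : ℂ^{n×n} → ℂ^{n×n} that preserves inner products and satisfies U(ψ ⊗ e₀) = ψ ⊗ ψ for every unit vector ψ ∈ H. -/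
/-- The standard Hermitian inner product `⟨v, w⟩ = ∑ i, conj (v i) * w i`. -/
noncomputable def hermInner {ι : Type*} [Fintype ι] (v w : ι → ℂ) : ℂ :=
  ∑ i, star (v i) * w i

/-- The componentwise tensor product of two vectors in `ℂ^n`, realized as an element of
`ℂ^{n×n}`: `(ψ ⊗ φ)(i,j) = ψ i * φ j`. -/
def tensorVec {n : ℕ} (ψ φ : Fin n → ℂ) : Fin n × Fin n → ℂ :=
  fun p => ψ p.1 * φ p.2

theorem hermInner_tensorVec {n : ℕ} (ψ φ ψ' φ' : Fin n → ℂ) :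
    hermInner (tensorVec ψ φ) (tensorVec ψ' φ') = hermInner ψ ψ' * hermInner φ φ' := by
  simp only [hermInner, tensorVec, Fintype.sum_prod_type, Finset.sum_mul_sum, star_mul']
  exact Finset.sum_congr rfl fun i _ => Finset.sum_congr rfl fun j _ => by ring

theorem hermInner_single_left {ι : Type*} [Fintype ι] [DecidableEq ι] (i : ι) (w : ι → ℂ) :
    hermInner (Pi.single i 1) w = w i := by
  simp [hermInner, Pi.single_apply, apply_ite (starRingEnd ℂ)]

/-- The inner product of two vectors cloned by the same isometry is idempotent. -/
theorem hermInner_eq_sq_of_cloned {n : ℕ} {e₀ ψ φ : Fin n → ℂ} (he₀ : hermInner e₀ e₀ = 1)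
    {U : (Fin n × Fin n → ℂ) → (Fin n × Fin n → ℂ)}
    (hU : ∀ v w : Fin n × Fin n → ℂ, hermInner (U v) (U w) = hermInner v w)
    (hψ : U (tensorVec ψ e₀) = tensorVec ψ ψ) (hφ : U (tensorVec φ e₀) = tensorVec φ φ) :
    hermInner ψ φ = hermInner ψ φ ^ 2 := by
  have h := hU (tensorVec ψ e₀) (tensorVec φ e₀)
  rw [hψ, hφ, hermInner_tensorVec, hermInner_tensorVec, he₀, mul_one] at h
  rw [sq, h]

/-- No-cloning: for `n ≥ 2` and a fixed unit vector `e₀ ∈ ℂ^n`, there is no linear map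
`U : ℂ^{n×n} → ℂ^{n×n}` preserving inner products with `U (ψ ⊗ e₀) = ψ ⊗ ψ` for every
unit vector `ψ`. -/
theorem no_cloning {n : ℕ} (hn : 2 ≤ n) (e₀ : Fin n → ℂ) (he₀ : hermInner e₀ e₀ = 1) :
    ¬ ∃ U : (Fin n × Fin n → ℂ) →ₗ[ℂ] (Fin n × Fin n → ℂ),
        (∀ v w : Fin n × Fin n → ℂ, hermInner (U v) (U w) = hermInner v w) ∧
        (∀ ψ : Fin n → ℂ, hermInner ψ ψ = 1 → U (tensorVec ψ e₀) = tensorVec ψ ψ) := by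
  rintro ⟨U, hU, hclone⟩
  let i : Fin n := ⟨0, by omega⟩
  let j : Fin n := ⟨1, by omega⟩
  have hij : i ≠ j := by simp [i, j]
  let φ : Fin n → ℂ := Pi.single i (3 / 5) + Pi.single j (4 / 5)
  have hφi : φ i = 3 / 5 := by simp [φ, hij]
  have hφj : φ j = 4 / 5 := by simp [φ, hij.symm]
  have hφ : hermInner φ φ = 1 := by
    unfold hermInner
    rw [Fintype.sum_eq_add i j hij fun k hk => by simp [φ, hk.1, hk.2], hφi, hφj]
    norm_num [Complex.ext_iff]
  have hψ : hermInner (Pi.single i 1 : Fin n → ℂ) (Pi.single i 1) = 1 := by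
    rw [hermInner_single_left, Pi.single_eq_same]
  have h := hermInner_eq_sq_of_cloned he₀ hU (hclone _ hψ) (hclone φ hφ)
  rw [hermInner_single_left, hφi] at h
  norm_num at h
end

section
/- Let X be a countable set and idx : X → ℕ an injection. For t ∈ ℕ let A_t := {x ∈ X : idx(x) ≤ t}, and define the learner G on a sample S = (x₁,…,x_d) ∈ X^d by G(S) := A_{T(S)} where T(S) := max_{1 ≤ j ≤ d} idx(x_j). Then each G(S) is a finite subset of X, and for every ε, δ ∈ (0,1) and every finitely supported probability distribution P on X, if d ≥ ln(1/δ) / (−ln(1−ε)), then the probability under the i.i.d. product P^d that P(G(S)) ≥ 1 − ε is at least 1 − δ. In fact this probability is at least 1 − (1−ε)^d. -/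
open scoped ENNReal

/-- A sum over tuples of products of coordinate functions is the product of the sums. -/
theorem ENNReal.tsum_pi_prod {X : Type*} (f : X → ℝ≥0∞) (d : ℕ) :
    ∑' s : Fin d → X, ∏ i, f (s i) = (∑' x, f x) ^ d := by
  induction d with
  | zero => simp
  | succ n ih =>
    rw [← (Fin.consEquiv fun _ : Fin (n + 1) => X).tsum_eq, ENNReal.tsum_prod', pow_succ', ← ih,
      ← ENNReal.tsum_mul_right]
    refine tsum_congr fun x => ?_
    rw [← ENNReal.tsum_mul_left]
    refine tsum_congr fun s => ?_
    simp [Fin.consEquiv, Fin.prod_univ_succ]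

/-- An event contained in the cube `Bᵈ` has probability at most `P(B)ᵈ`. -/
theorem iidProb_le_pow {X : Type*} {d : ℕ} (P : PMF X) (E : Set (Fin d → X)) (B : Set X)
    (h : ∀ s ∈ E, ∀ i, s i ∈ B) : iidProb P E ≤ P.toOuterMeasure B ^ d := by
  rw [PMF.toOuterMeasure_apply, ← ENNReal.tsum_pi_prod]
  refine ENNReal.tsum_le_tsum fun s => ?_
  by_cases hs : s ∈ E
  · rw [Set.indicator_of_mem hs]
    exact (Finset.prod_congr rfl fun i _ => (Set.indicator_of_mem (h s hs i) _).symm).le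
  · simp [Set.indicator_of_notMem hs]

/-- For a finitely supported `P` and a level `c ≤ 1`, there is a threshold `t` at which the
initial segments reach mass `c`, with at most `c` mass strictly below `t`. -/
theorem PMF.exists_quantile {X : Type*} (idx : X → ℕ) (P : PMF X) (hP : P.support.Finite)
    (c : ℝ≥0∞) (hc : c ≤ 1) :
    ∃ t, c ≤ P.toOuterMeasure {x | idx x ≤ t} ∧ P.toOuterMeasure {x | idx x < t} ≤ c := by
  classical
  have hex : ∃ t, c ≤ P.toOuterMeasure {x | idx x ≤ t} := by
    refine ⟨hP.toFinset.sup idx, hc.trans ?_⟩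
    refine ((P.toOuterMeasure_apply_eq_one_iff _).2 fun x hx => ?_).ge
    exact Finset.le_sup (f := idx) (hP.mem_toFinset.2 hx)
  refine ⟨Nat.find hex, Nat.find_spec hex, ?_⟩
  rcases h : Nat.find hex with _ | n
  · simp
  · have := Nat.find_min hex (m := n) (by omega)
    simpa only [Nat.lt_succ_iff] using (not_le.1 this).le

theorem pow_le_of_log_div_le {ε δ : ℝ} (hε : ε ∈ Set.Ioo (0 : ℝ) 1) (hδ : 0 < δ) {d : ℕ}
    (h : Real.log (1 / δ) / (-Real.log (1 - ε)) ≤ (d : ℝ)) : (1 - ε) ^ d ≤ δ := by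
  have h1 : 0 < 1 - ε := sub_pos.2 hε.2
  have hlog : Real.log (1 - ε) < 0 := Real.log_neg h1 (by linarith [hε.1])
  rw [div_le_iff₀ (neg_pos.2 hlog), one_div, Real.log_inv] at h
  rw [← Real.log_le_log_iff (pow_pos h1 d) hδ, Real.log_pow]
  linarith

/-- The quantile learner for the finite-subset class on a countable domain: on a sample
`S`, it outputs the initial segment `A_{T(S)} = {x : idx x ≤ max_j idx (S j)}`. Each
output is finite, and for any finitely supported `P` the output captures `P`-mass at
least `1 - ε` with `P^d`-probability at least `1 - (1-ε)^d`, hence at least `1 - δ`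
whenever `d ≥ ln(1/δ) / (-ln(1-ε))`. -/
theorem quantile_learner {X : Type*} [Countable X]
    (idx : X → ℕ) (hidx : Function.Injective idx) (d : ℕ) :
    (∀ S : Fin d → X,
      {x : X | idx x ≤ Finset.univ.sup fun j => idx (S j)}.Finite) ∧
    (∀ ε δ : ℝ, ε ∈ Set.Ioo (0 : ℝ) 1 → δ ∈ Set.Ioo (0 : ℝ) 1 →
      ∀ P : PMF X, P.support.Finite →
        (1 - ENNReal.ofReal ((1 - ε) ^ d) ≤
          iidProb P {S : Fin d → X |
            1 - ENNReal.ofReal ε ≤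
              P.toOuterMeasure {x : X | idx x ≤ Finset.univ.sup fun j => idx (S j)}}) ∧
        (Real.log (1 / δ) / (-Real.log (1 - ε)) ≤ (d : ℝ) →
          1 - ENNReal.ofReal δ ≤
            iidProb P {S : Fin d → X |
              1 - ENNReal.ofReal ε ≤
                P.toOuterMeasure {x : X | idx x ≤ Finset.univ.sup fun j => idx (S j)}})) := by
  refine ⟨fun S => (Set.finite_Iic _).preimage hidx.injOn, fun ε δ hε hδ P hP => ?_⟩
  have hc : 1 - ENNReal.ofReal ε = ENNReal.ofReal (1 - ε) := by
    rw [ENNReal.ofReal_sub _ hε.1.le, ENNReal.ofReal_one]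
  have key : 1 - ENNReal.ofReal ((1 - ε) ^ d) ≤
      iidProb P {S : Fin d → X |
        1 - ENNReal.ofReal ε ≤
          P.toOuterMeasure {x : X | idx x ≤ Finset.univ.sup fun j => idx (S j)}} := by
    obtain ⟨t, ht, htc⟩ := P.exists_quantile idx hP (1 - ENNReal.ofReal ε) tsub_le_self
    rw [tsub_le_iff_right, ENNReal.ofReal_pow (sub_nonneg.2 hε.2.le), ← hc]
    refine (iidProb_add_compl P _).ge.trans (add_le_add_right ?_ _)
    refine (iidProb_le_pow P _ {x | idx x < t} fun S hS i => ?_).trans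
      (pow_le_pow_left₀ zero_le htc d)
    by_contra hi
    refine hS (ht.trans (P.toOuterMeasure.mono fun x hx => ?_))
    exact (le_trans hx (not_lt.1 hi)).trans
      (Finset.le_sup (f := fun j => idx (S j)) (Finset.mem_univ i))
  exact ⟨key, fun h => le_trans (tsub_le_tsub_left
    (ENNReal.ofReal_le_ofReal (pow_le_of_log_div_le hε hδ.1 h)) 1) key⟩
end
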